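/- arXiv:1611.03564 — 2 statements merged into one kernel-verified Lean document; each statement's English description precedes it below -/
import Mathlib

section
/- There exists a finite constant C such that for every r ≥ 1 and every y ∈ ℍ¹, (1/σ(∂B₁)) ∫_{∂B₁} ρ( y⁻¹ · δ_r(ξ) )⁻² dσ(ξ) ≤ C/r². Consequently, if f ∈ L¹(ℍ¹, dv), then (1/σ(∂B₁)) ∫_{∂B₁} ∫_{ℍ¹} |f(y)| ρ( y⁻¹ · δ_r(ξ) )⁻² dv(y) dσ(ξ) ≤ C‖f‖_{L¹} / r²; i.e., the spherical average over ∂B_r of the quantity bounding |Δ_b v|, for v(x) := ∫_{ℍ¹} log( ρ(y)/ρ(y⁻¹x) ) f(y) dv(y), is O(1/r²) as r → ∞. -/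
open MeasureTheory Real

noncomputable section

/-- The Heisenberg group `ℍ¹` as `ℝ³` with coordinates `(x, y, t)`. -/
abbrev Heis : Type := ℝ × ℝ × ℝ

/-- Group law `(z,t)·(z',t') = (z+z', t+t'+2 Im(z ⬝ conj z'))`. -/
def Hmul (p q : Heis) : Heis :=
  (p.1 + q.1, p.2.1 + q.2.1, p.2.2 + q.2.2 + 2 * (p.2.1 * q.1 - p.1 * q.2.1))

/-- Group inverse `(z,t)⁻¹ = (-z,-t)`. -/
def Hinv (p : Heis) : Heis := (-p.1, -p.2.1, -p.2.2)

/-- Korányi norm `ρ(z,t) = (|z|⁴ + t²)^(1/4)`. -/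
def rho (p : Heis) : ℝ := ((p.1 ^ 2 + p.2.1 ^ 2) ^ 2 + p.2.2 ^ 2) ^ ((1 : ℝ) / 4)

/-- Korányi ball `B(p,r) = {q : ρ(p⁻¹ q) < r}`. -/
def Kball (p : Heis) (r : ℝ) : Set Heis := {q | rho (Hmul (Hinv p) q) < r}

/-- The left-invariant vector field `X = ∂ₓ + 2y ∂_t` acting on a function. -/
def Xd (f : Heis → ℝ) (p : Heis) : ℝ := fderiv ℝ f p (1, 0, 2 * p.2.1)

/-- The left-invariant vector field `Y = ∂_y − 2x ∂_t` acting on a function. -/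
def Yd (f : Heis → ℝ) (p : Heis) : ℝ := fderiv ℝ f p (0, 1, -(2 * p.1))

/-- The vector field `T = ∂_t`. -/
def Td (f : Heis → ℝ) (p : Heis) : ℝ := fderiv ℝ f p (0, 0, 1)

/-- Sub-Laplacian `Δ_b = X² + Y²`. -/
def subLap (f : Heis → ℝ) : Heis → ℝ := fun p => Xd (Xd f) p + Yd (Yd f) p

/-- Squared length of the horizontal gradient: `|∇_b f|² = (Xf)² + (Yf)²`. -/
def gradb2 (f : Heis → ℝ) (p : Heis) : ℝ := (Xd f p) ^ 2 + (Yd f p) ^ 2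

/-- The open unit disk in the `(x₁,x₂)`-plane. -/
def unitDisk : Set (ℝ × ℝ) := {v | v.1 ^ 2 + v.2 ^ 2 < 1}

/-- `g(x₁,x₂) = √(1 − (x₁²+x₂²)²)`, whose graphs are the two halves of the Korányi
unit sphere. -/
def gcap (v : ℝ × ℝ) : ℝ := Real.sqrt (1 - (v.1 ^ 2 + v.2 ^ 2) ^ 2)

/-- Area density `√((∂_{x₁}u − x₂)² + (∂_{x₂}u + x₁)²)` of the graph of `u`. -/
def graphDens (u : ℝ × ℝ → ℝ) (v : ℝ × ℝ) : ℝ :=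
  Real.sqrt ((fderiv ℝ u v (1, 0) - v.2) ^ 2 + (fderiv ℝ u v (0, 1) + v.1) ^ 2)

/-- The surface measure `σ` on the Korányi unit sphere `∂B₁ = {ρ = 1}`: the sum of the
pushforwards, under the two graph maps `(x₁,x₂) ↦ (x₁,x₂,±g)`, of the corresponding
area densities on the unit disk. -/
def sigmaSphere : Measure Heis :=
  Measure.map (fun v : ℝ × ℝ => (v.1, v.2, gcap v))
      ((volume.restrict unitDisk).withDensity fun v => ENNReal.ofReal (graphDens gcap v))
    + Measure.map (fun v : ℝ × ℝ => (v.1, v.2, -gcap v))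
      ((volume.restrict unitDisk).withDensity
        fun v => ENNReal.ofReal (graphDens (fun w => -gcap w) v))

/-- Heisenberg dilation `δ_r(z,t) = (rz, r²t)`. -/
def Hdil (r : ℝ) (p : Heis) : Heis := (r * p.1, r * p.2.1, r ^ 2 * p.2.2)

/-- The singularity `|x|^(-q)` is integrable on `[-1, 1]` for `q < 1`. -/
theorem lintegral_enorm_rpow_neg_ne_top {q : ℝ} (hq : q < 1) :
    ∫⁻ x in Set.Icc (-1 : ℝ) 1, ‖x‖ₑ ^ (-q) ≠ ⊤ := by
  have hpos : ∫⁻ x in Set.Ioc (0 : ℝ) 1, ‖x‖ₑ ^ (-q) < ⊤ := by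
    have hint : IntegrableOn (fun x : ℝ => x ^ (-q)) (Set.Ioc 0 1) :=
      (intervalIntegrable_iff_integrableOn_Ioc_of_le zero_le_one).1
        (intervalIntegral.intervalIntegrable_rpow' (by linarith))
    refine lt_of_eq_of_lt ?_ hint.2
    refine setLIntegral_congr_fun measurableSet_Ioc fun x hx => ?_
    simp only [Real.enorm_eq_ofReal hx.1.le, ENNReal.ofReal_rpow_of_pos hx.1,
      Real.enorm_eq_ofReal (rpow_nonneg hx.1.le _)]
  have hneg : ∫⁻ x in Set.Ico (-1 : ℝ) 0, ‖x‖ₑ ^ (-q) = ∫⁻ x in Set.Ioc (0 : ℝ) 1, ‖x‖ₑ ^ (-q) := by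
    have := (Measure.measurePreserving_neg (volume : Measure ℝ)).setLIntegral_comp_preimage_emb
      (MeasurableEquiv.neg ℝ).measurableEmbedding (fun x : ℝ => ‖x‖ₑ ^ (-q)) (Set.Ioc (0 : ℝ) 1)
    simpa using this
  have hzero : ∫⁻ x in ({0} : Set ℝ), ‖x‖ₑ ^ (-q) = 0 :=
    setLIntegral_measure_zero _ _ (by simp)
  have hsub : Set.Icc (-1 : ℝ) 1 ⊆ (Set.Ico (-1) 0 ∪ {0}) ∪ Set.Ioc 0 1 := by
    intro x hx
    rcases lt_trichotomy x 0 with h | h | h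
    · exact Or.inl (Or.inl ⟨hx.1, h⟩)
    · exact Or.inl (Or.inr h)
    · exact Or.inr ⟨h, hx.2⟩
  refine ne_of_lt (lt_of_le_of_lt ((lintegral_mono_set hsub).trans
    ((lintegral_union_le _ _ _).trans (add_le_add_left (lintegral_union_le _ _ _) _))) ?_)
  rw [hneg, hzero, add_zero]
  exact ENNReal.add_lt_top.2 ⟨hpos, hpos⟩

/-- Integrals of translates of `|x|^(-q)` are bounded independently of the translation. -/
theorem setLIntegral_enorm_add_rpow_neg_le {q : ℝ} (hq : 0 < q) (s : Set ℝ) (c : ℝ) :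
    ∫⁻ x in s, ‖x + c‖ₑ ^ (-q) ≤ volume s + ∫⁻ x in Set.Icc (-1 : ℝ) 1, ‖x‖ₑ ^ (-q) := by
  have hle : ∀ x : ℝ,
      ‖x‖ₑ ^ (-q) ≤ 1 + (Set.Icc (-1 : ℝ) 1).indicator (fun x => ‖x‖ₑ ^ (-q)) x := by
    intro x
    by_cases hx : x ∈ Set.Icc (-1 : ℝ) 1
    · simp [Set.indicator_of_mem hx]
    · rw [Set.indicator_of_notMem hx, add_zero]
      have h1 : (1 : ENNReal) ≤ ‖x‖ₑ := by
        rw [Real.enorm_eq_ofReal_abs, ENNReal.one_le_ofReal]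
        by_contra! h
        exact hx (abs_le.1 h.le)
      rw [ENNReal.rpow_neg]
      exact ENNReal.inv_le_one.2 (ENNReal.one_le_rpow h1 hq)
  calc ∫⁻ x in s, ‖x + c‖ₑ ^ (-q)
      ≤ ∫⁻ x in s, (1 + (Set.Icc (-1 : ℝ) 1).indicator (fun x => ‖x‖ₑ ^ (-q)) (x + c)) :=
        lintegral_mono fun x => hle _
    _ = volume s + ∫⁻ x in s, (Set.Icc (-1 : ℝ) 1).indicator (fun x => ‖x‖ₑ ^ (-q)) (x + c) := by
        rw [lintegral_add_left measurable_const, setLIntegral_one]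
    _ ≤ volume s + ∫⁻ x, (Set.Icc (-1 : ℝ) 1).indicator (fun x => ‖x‖ₑ ^ (-q)) (x + c) := by
        gcongr; exact Measure.restrict_le_self
    _ = _ := by
        rw [lintegral_add_right_eq_self
          (fun x => (Set.Icc (-1 : ℝ) 1).indicator (fun x => ‖x‖ₑ ^ (-q)) x) c,
          lintegral_indicator measurableSet_Icc]

/-- The angles at which the cosine is at least `1 / 2`, within a full turn. -/
theorem abs_le_pi_div_three {x : ℝ} (hx : |x| ≤ π) (hc : 1 / 2 ≤ cos x) : |x| ≤ π / 3 := by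
  by_contra! h
  have := cos_lt_cos_of_nonneg_of_le_pi (by positivity) hx h
  rw [cos_pi_div_three, cos_abs] at this
  linarith

/-- Substituting `u = sin (θ - a)` on an interval where the cosine is at least `1 / 2`. -/
theorem setLIntegral_comp_sin_le (f : ℝ → ENNReal) (a : ℝ) (n : ℤ) :
    ∫⁻ θ in Set.Icc (a + n * (2 * π) - π / 3) (a + n * (2 * π) + π / 3), f (sin (θ - a))
      ≤ 2 * ∫⁻ u in Set.Icc (-1 : ℝ) 1, f u := by
  set s := Set.Icc (a + n * (2 * π) - π / 3) (a + n * (2 * π) + π / 3) with hs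
  have hcos : ∀ θ ∈ s, 1 / 2 ≤ cos (θ - a) := by
    intro θ hθ
    rw [← cos_sub_int_mul_two_pi (θ - a) n, ← cos_abs, ← cos_pi_div_three]
    refine cos_le_cos_of_nonneg_of_le_pi (abs_nonneg _) (by linarith [pi_pos]) ?_
    rw [abs_le]
    constructor <;> linarith [hθ.1, hθ.2]
  have hderiv : ∀ θ, HasDerivAt (fun θ => sin (θ - a)) (cos (θ - a)) θ := fun θ => by
    simpa using ((hasDerivAt_id θ).sub_const a).sin
  have hinj : Set.InjOn (fun θ => sin (θ - a)) s := by
    refine (strictMonoOn_of_deriv_pos (convex_Icc _ _) (by fun_prop) fun θ hθ => ?_).injOn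
    rw [(hderiv θ).deriv]
    linarith [hcos θ (interior_subset hθ)]
  calc ∫⁻ θ in s, f (sin (θ - a))
      ≤ ∫⁻ θ in s, 2 * (ENNReal.ofReal |cos (θ - a)| * f (sin (θ - a))) := by
        refine setLIntegral_mono' measurableSet_Icc fun θ hθ => ?_
        rw [← mul_assoc]
        refine le_mul_of_one_le_left zero_le ?_
        rw [← ENNReal.ofReal_ofNat 2, ← ENNReal.ofReal_mul (by norm_num), ENNReal.one_le_ofReal]
        linarith [hcos θ hθ, le_abs_self (cos (θ - a))]
    _ = 2 * ∫⁻ u in (fun θ => sin (θ - a)) '' s, f u := by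
        rw [lintegral_const_mul' _ _ (by simp), lintegral_image_eq_lintegral_abs_deriv_mul
          measurableSet_Icc (fun θ _ => (hderiv θ).hasDerivWithinAt) hinj]
    _ ≤ _ := by
        gcongr
        rintro _ ⟨θ, -, rfl⟩
        exact sin_mem_Icc _

theorem setLIntegral_comp_sin_le_of_half_le_cos (f : ℝ → ENNReal) {a : ℝ} (ha : |a| ≤ π) :
    ∫⁻ θ in Set.Ioo (-π) π ∩ {θ | 1 / 2 ≤ cos (θ - a)}, f (sin (θ - a))
      ≤ 6 * ∫⁻ u in Set.Icc (-1 : ℝ) 1, f u := by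
  let T : ℤ → Set ℝ := fun n => Set.Icc (a + n * (2 * π) - π / 3) (a + n * (2 * π) + π / 3)
  have hmem : ∀ (n : ℤ) (θ : ℝ), |θ - a - n * (2 * π)| ≤ π → 1 / 2 ≤ cos (θ - a) → θ ∈ T n := by
    intro n θ h hc
    rw [← cos_sub_int_mul_two_pi (θ - a) n] at hc
    have := abs_le.1 (abs_le_pi_div_three h hc)
    constructor <;> linarith [this.1, this.2]
  have hsub : Set.Ioo (-π) π ∩ {θ | 1 / 2 ≤ cos (θ - a)} ⊆ (T (-1) ∪ T 0) ∪ T 1 := by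
    rintro θ ⟨⟨h1, h2⟩, hc⟩
    have ha' := abs_le.1 ha
    rcases le_or_gt (θ - a) (-π) with h | h
    · refine Or.inl (Or.inl (hmem _ _ (abs_le.2 ?_) hc))
      push_cast
      constructor <;> linarith
    rcases le_or_gt (θ - a) π with h' | h'
    · refine Or.inl (Or.inr (hmem _ _ (abs_le.2 ?_) hc))
      push_cast
      constructor <;> linarith
    · refine Or.inr (hmem _ _ (abs_le.2 ?_) hc)
      push_cast
      constructor <;> linarith
  calc _ ≤ ∫⁻ θ in (T (-1) ∪ T 0) ∪ T 1, f (sin (θ - a)) := lintegral_mono_set hsub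
    _ ≤ ((∫⁻ θ in T (-1), f (sin (θ - a))) + ∫⁻ θ in T 0, f (sin (θ - a)))
          + ∫⁻ θ in T 1, f (sin (θ - a)) :=
        (lintegral_union_le _ _ _).trans (add_le_add_left (lintegral_union_le _ _ _) _)
    _ ≤ (2 * ∫⁻ u in Set.Icc (-1 : ℝ) 1, f u) + (2 * ∫⁻ u in Set.Icc (-1 : ℝ) 1, f u)
          + (2 * ∫⁻ u in Set.Icc (-1 : ℝ) 1, f u) := by
        gcongr <;> exact setLIntegral_comp_sin_le f a _
    _ = _ := by ring

/-- In polar form, the singular kernel is bounded by a constant multiple of `R⁻²`, up to a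
transversal singularity that is only present where the cosine is at least `1 / 2`. -/
theorem inv_ofReal_sqrt_le {R A : ℝ} (hR : 0 < R) (hR1 : R < 1) (hA : 0 ≤ A) (b φ : ℝ) :
    (ENNReal.ofReal √((R ^ 2 + A ^ 2 - 2 * R * A * cos φ) ^ 2 + (b + 2 * R * A * sin φ) ^ 2))⁻¹
      ≤ (ENNReal.ofReal (R ^ 2))⁻¹ * (4 + {φ | 1 / 2 ≤ cos φ}.indicator (fun φ =>
          ‖R - A‖ₑ ^ (-(1 / 4) : ℝ) * ‖sin φ + b / (2 * R * A)‖ₑ ^ (-(7 / 8) : ℝ)) φ) := by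
  set P := R ^ 2 + A ^ 2 - 2 * R * A * cos φ with hP
  set h := b + 2 * R * A * sin φ with hh
  have hRA : 0 ≤ R * A := mul_nonneg hR.le hA
  have hP0 : (R - A) ^ 2 ≤ P := by nlinarith [cos_le_one φ]
  have hXP : P ≤ √(P ^ 2 + h ^ 2) := Real.le_sqrt_of_sq_le (by nlinarith [sq_nonneg h])
  have hXh : |h| ≤ √(P ^ 2 + h ^ 2) :=
    Real.le_sqrt_of_sq_le (by rw [sq_abs]; nlinarith [sq_nonneg P])
  have hfar : R ^ 2 / 4 ≤ P → (ENNReal.ofReal √(P ^ 2 + h ^ 2))⁻¹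
      ≤ (ENNReal.ofReal (R ^ 2))⁻¹ * 4 := by
    intro hle
    calc (ENNReal.ofReal √(P ^ 2 + h ^ 2))⁻¹ ≤ (ENNReal.ofReal (R ^ 2 / 4))⁻¹ :=
          ENNReal.inv_le_inv.2 (ENNReal.ofReal_le_ofReal (hle.trans hXP))
      _ = _ := by
          rw [← ENNReal.ofReal_inv_of_pos (by positivity), ← ENNReal.ofReal_inv_of_pos (by positivity),
            ← ENNReal.ofReal_ofNat 4, ← ENNReal.ofReal_mul (by positivity)]
          congr 1
          field_simp
  by_cases hfarc : R ^ 2 / 4 ≤ P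
  · exact (hfar hfarc).trans (mul_le_mul_right le_self_add _)
  have hcos : 1 / 2 ≤ cos φ := by
    by_contra! hc
    nlinarith [sq_nonneg (R - 2 * A)]
  have hRA2 : R ≤ 2 * A := by
    by_contra! hlt
    nlinarith
  have hA0 : 0 < A := by linarith
  rw [Set.indicator_of_mem (show φ ∈ {φ | 1 / 2 ≤ cos φ} from hcos)]
  refine le_trans ?_ (mul_le_mul_right le_add_self _)
  set x := ENNReal.ofReal √(P ^ 2 + h ^ 2) with hx
  set r := ENNReal.ofReal (R ^ 2) with hr
  set s := sin φ + b / (2 * R * A) with hs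
  have hx1 : ‖R - A‖ₑ ^ 2 ≤ x := by
    rw [Real.enorm_eq_ofReal_abs, ← ENNReal.ofReal_pow (abs_nonneg _), sq_abs]
    exact ENNReal.ofReal_le_ofReal (hP0.trans hXP)
  have hx2 : r * ‖s‖ₑ ≤ x := by
    rw [Real.enorm_eq_ofReal_abs, ← ENNReal.ofReal_mul (sq_nonneg R)]
    refine ENNReal.ofReal_le_ofReal (le_trans ?_ hXh)
    have : h = 2 * R * A * s := by rw [hh, hs]; field_simp; ring
    rw [this, abs_mul, abs_of_pos (by positivity : 0 < 2 * R * A)]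
    exact mul_le_mul_of_nonneg_right (by nlinarith) (abs_nonneg _)
  have hr1 : r ≤ 1 := by
    rw [hr, ENNReal.ofReal_le_one]
    nlinarith
  have hprod : r * (‖R - A‖ₑ ^ (1 / 4 : ℝ) * ‖s‖ₑ ^ (7 / 8 : ℝ)) ≤ x :=
    calc r * (‖R - A‖ₑ ^ (1 / 4 : ℝ) * ‖s‖ₑ ^ (7 / 8 : ℝ))
        ≤ r ^ (7 / 8 : ℝ) * (‖R - A‖ₑ ^ (1 / 4 : ℝ) * ‖s‖ₑ ^ (7 / 8 : ℝ)) := by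
          gcongr
          simpa using ENNReal.rpow_le_rpow_of_exponent_ge hr1 (by norm_num : (7 / 8 : ℝ) ≤ 1)
      _ = (‖R - A‖ₑ ^ 2) ^ (1 / 8 : ℝ) * (r * ‖s‖ₑ) ^ (7 / 8 : ℝ) := by
          rw [ENNReal.mul_rpow_of_nonneg _ _ (by norm_num), ← ENNReal.rpow_natCast,
            ← ENNReal.rpow_mul]
          norm_num
          ring
      _ ≤ x ^ (1 / 8 : ℝ) * x ^ (7 / 8 : ℝ) := by gcongr
      _ = x := by
          rw [← ENNReal.rpow_add_of_nonneg _ _ (by norm_num) (by norm_num)]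
          norm_num
  refine (ENNReal.inv_le_inv.2 hprod).trans_eq ?_
  have h4 : ‖R - A‖ₑ ^ (1 / 4 : ℝ) ≠ ⊤ := ENNReal.rpow_ne_top_of_nonneg (by norm_num) enorm_ne_top
  have h8 : ‖s‖ₑ ^ (7 / 8 : ℝ) ≠ ⊤ := ENNReal.rpow_ne_top_of_nonneg (by norm_num) enorm_ne_top
  rw [ENNReal.mul_inv (Or.inr (ENNReal.mul_ne_top h4 h8)) (Or.inl ENNReal.ofReal_ne_top),
    ENNReal.mul_inv (Or.inr h8) (Or.inl h4), ENNReal.rpow_neg, ENNReal.rpow_neg]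

/-- The bound, after integration over a circle of radius `r < 1`. -/
theorem lintegral_circle_le {r : ℝ} (hr : 0 < r) (hr1 : r < 1) (a : ℂ) (b : ℝ) :
    ENNReal.ofReal (r ^ 2) * ∫⁻ θ in Set.Ioo (-π) π,
        (ENNReal.ofReal √(((r * cos θ - a.re) ^ 2 + (r * sin θ - a.im) ^ 2) ^ 2
          + (b + 2 * (a.re * (r * sin θ) - a.im * (r * cos θ))) ^ 2))⁻¹
      ≤ 4 * ENNReal.ofReal (2 * π) + ‖r - ‖a‖‖ₑ ^ (-(1 / 4) : ℝ)
          * (6 * (2 + ∫⁻ x in Set.Icc (-1 : ℝ) 1, ‖x‖ₑ ^ (-(7 / 8) : ℝ))) := by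
  set A := ‖a‖
  set c := b / (2 * r * A)
  have hre : a.re = A * cos a.arg := (Complex.norm_mul_cos_arg a).symm
  have him : a.im = A * sin a.arg := (Complex.norm_mul_sin_arg a).symm
  have hr0 : ENNReal.ofReal (r ^ 2) ≠ 0 := by simpa using hr.ne'
  have hmeas : MeasurableSet {θ : ℝ | 1 / 2 ≤ cos (θ - a.arg)} :=
    measurableSet_le measurable_const (by fun_prop)
  calc _ ≤ ENNReal.ofReal (r ^ 2) * ∫⁻ θ in Set.Ioo (-π) π, (ENNReal.ofReal (r ^ 2))⁻¹ *
          (4 + {θ : ℝ | 1 / 2 ≤ cos (θ - a.arg)}.indicator (fun θ =>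
            ‖r - A‖ₑ ^ (-(1 / 4) : ℝ) * ‖sin (θ - a.arg) + c‖ₑ ^ (-(7 / 8) : ℝ)) θ) := by
        gcongr with θ
        have h1 : (r * cos θ - a.re) ^ 2 + (r * sin θ - a.im) ^ 2
            = r ^ 2 + A ^ 2 - 2 * r * A * cos (θ - a.arg) := by
          rw [hre, him, cos_sub]
          linear_combination r ^ 2 * sin_sq_add_cos_sq θ + A ^ 2 * sin_sq_add_cos_sq a.arg
        have h2 : b + 2 * (a.re * (r * sin θ) - a.im * (r * cos θ))
            = b + 2 * r * A * sin (θ - a.arg) := by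
          rw [hre, him, sin_sub]
          ring
        rw [h1, h2]
        exact inv_ofReal_sqrt_le hr hr1 (norm_nonneg a) b (θ - a.arg)
    _ = ∫⁻ θ in Set.Ioo (-π) π, (4 + {θ : ℝ | 1 / 2 ≤ cos (θ - a.arg)}.indicator (fun θ =>
            ‖r - A‖ₑ ^ (-(1 / 4) : ℝ) * ‖sin (θ - a.arg) + c‖ₑ ^ (-(7 / 8) : ℝ)) θ) := by
        rw [lintegral_const_mul' _ _ (ENNReal.inv_ne_top.2 hr0), ← mul_assoc,
          ENNReal.mul_inv_cancel hr0 ENNReal.ofReal_ne_top, one_mul]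
    _ = 4 * ENNReal.ofReal (2 * π) + ‖r - A‖ₑ ^ (-(1 / 4) : ℝ) *
          ∫⁻ θ in Set.Ioo (-π) π ∩ {θ | 1 / 2 ≤ cos (θ - a.arg)},
            ‖sin (θ - a.arg) + c‖ₑ ^ (-(7 / 8) : ℝ) := by
        rw [lintegral_add_left measurable_const, setLIntegral_const, Real.volume_Ioo,
          lintegral_indicator hmeas, Measure.restrict_restrict hmeas, Set.inter_comm,
          lintegral_const_mul _ (by fun_prop),
          show π - -π = 2 * π by ring]
    _ ≤ _ := by
        gcongr
        refine (setLIntegral_comp_sin_le_of_half_le_cos (fun u => ‖u + c‖ₑ ^ (-(7 / 8) : ℝ))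
          (Complex.abs_arg_le_pi a)).trans ?_
        gcongr
        refine (setLIntegral_enorm_add_rpow_neg_le (by norm_num) _ _).trans_eq ?_
        norm_num

/-- A pointwise bound for a product of two singularities with exponents `-1/2` and `-1/4`. -/
theorem rpow_neg_half_mul_rpow_neg_quarter_le (x y : ENNReal) :
    x ^ (-(1 / 2) : ℝ) * y ^ (-(1 / 4) : ℝ) ≤ x ^ (-(3 / 4) : ℝ) + y ^ (-(3 / 4) : ℝ) := by
  have key : ∀ u v : ENNReal,
      u ^ (1 / 2 : ℝ) * v ^ (1 / 4 : ℝ) ≤ u ^ (3 / 4 : ℝ) + v ^ (3 / 4 : ℝ) := by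
    intro u v
    have hmax : ∀ w : ENNReal, w ^ (1 / 2 : ℝ) * w ^ (1 / 4 : ℝ) = w ^ (3 / 4 : ℝ) := fun w => by
      rw [← ENNReal.rpow_add_of_nonneg _ _ (by norm_num) (by norm_num)]
      norm_num
    rcases le_total u v with h | h
    · calc _ ≤ v ^ (1 / 2 : ℝ) * v ^ (1 / 4 : ℝ) := by gcongr
        _ ≤ _ := by rw [hmax]; exact le_add_self
    · calc _ ≤ u ^ (1 / 2 : ℝ) * u ^ (1 / 4 : ℝ) := by gcongr
        _ ≤ _ := by rw [hmax]; exact le_self_add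
  simpa only [ENNReal.inv_rpow, ENNReal.rpow_neg] using key x⁻¹ y⁻¹

/-- The weighted integral over the unit disk is bounded uniformly in the centre `a` and in the
radial height function. -/
theorem exists_lintegral_unitDisk_le :
    ∃ K : ENNReal, K ≠ ⊤ ∧ ∀ (a : ℂ) (τ : ℝ → ℝ),
      ∫⁻ v in unitDisk, 2 * ENNReal.ofReal √(v.1 ^ 2 + v.2 ^ 2) *
        ‖1 - √(v.1 ^ 2 + v.2 ^ 2)‖ₑ ^ (-(1 / 2) : ℝ) *
        (ENNReal.ofReal √(((v.1 - a.re) ^ 2 + (v.2 - a.im) ^ 2) ^ 2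
          + (τ (v.1 ^ 2 + v.2 ^ 2) + 2 * (a.re * v.2 - a.im * v.1)) ^ 2))⁻¹ ≤ K := by
  set I : ℝ → ENNReal := fun q => ∫⁻ x in Set.Icc (-1 : ℝ) 1, ‖x‖ₑ ^ (-q) with hI
  set M : ENNReal := 4 * ENNReal.ofReal (2 * π)
  set N : ENNReal := 6 * (2 + I (7 / 8))
  have hN : N ≠ ⊤ := ENNReal.mul_ne_top (by simp) (ENNReal.add_ne_top.2
    ⟨by simp, lintegral_enorm_rpow_neg_ne_top (by norm_num)⟩)
  refine ⟨2 * (M * (1 + I (1 / 2)) + N * ((1 + I (3 / 4)) + (1 + I (3 / 4)))), ?_, ?_⟩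
  · have h1 : I (1 / 2) ≠ ⊤ := lintegral_enorm_rpow_neg_ne_top (by norm_num)
    have h2 : I (3 / 4) ≠ ⊤ := lintegral_enorm_rpow_neg_ne_top (by norm_num)
    have hM : M ≠ ⊤ := by finiteness
    finiteness
  intro a τ
  have hmeas : MeasurableSet unitDisk :=
    measurableSet_lt (by fun_prop) measurable_const
  set F : ℝ × ℝ → ENNReal := fun v => 2 * ENNReal.ofReal √(v.1 ^ 2 + v.2 ^ 2) *
        ‖1 - √(v.1 ^ 2 + v.2 ^ 2)‖ₑ ^ (-(1 / 2) : ℝ) *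
        (ENNReal.ofReal √(((v.1 - a.re) ^ 2 + (v.2 - a.im) ^ 2) ^ 2
          + (τ (v.1 ^ 2 + v.2 ^ 2) + 2 * (a.re * v.2 - a.im * v.1)) ^ 2))⁻¹ with hF
  set G : ℝ → ENNReal := fun r => 2 * (M * ‖r - 1‖ₑ ^ (-(1 / 2) : ℝ) +
      N * (‖r - 1‖ₑ ^ (-(3 / 4) : ℝ) + ‖r - ‖a‖‖ₑ ^ (-(3 / 4) : ℝ))) with hG
  have hradial : ∀ r ∈ Set.Ioi (0 : ℝ),
      ∫⁻ θ in Set.Ioo (-π) π, ENNReal.ofReal r * unitDisk.indicator F (r * cos θ, r * sin θ)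
        ≤ (Set.Ioo (0 : ℝ) 1).indicator G r := by
    intro r hr
    have hr : 0 < r := hr
    have hsq : ∀ θ, (r * cos θ) ^ 2 + (r * sin θ) ^ 2 = r ^ 2 := fun θ => by
      linear_combination r ^ 2 * sin_sq_add_cos_sq θ
    rcases lt_or_ge r 1 with hr1 | hr1
    · rw [Set.indicator_of_mem (show r ∈ Set.Ioo (0 : ℝ) 1 from ⟨hr, hr1⟩)]
      have hin : ∀ θ, ENNReal.ofReal r * unitDisk.indicator F (r * cos θ, r * sin θ)
          = (2 * ‖r - 1‖ₑ ^ (-(1 / 2) : ℝ) * ENNReal.ofReal (r ^ 2)) *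
            (ENNReal.ofReal √(((r * cos θ - a.re) ^ 2 + (r * sin θ - a.im) ^ 2) ^ 2
            + (τ (r ^ 2) + 2 * (a.re * (r * sin θ) - a.im * (r * cos θ))) ^ 2))⁻¹ := by
        intro θ
        rw [Set.indicator_of_mem (show (r * cos θ, r * sin θ) ∈ unitDisk by
          change (r * cos θ) ^ 2 + (r * sin θ) ^ 2 < 1
          rw [hsq]; nlinarith)]
        simp only [hF, hsq, Real.sqrt_sq hr.le]
        rw [ENNReal.ofReal_pow hr.le, enorm_sub_rev 1 r]
        ring
      have htop : ‖r - 1‖ₑ ^ (-(1 / 2) : ℝ) ≠ ⊤ := by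
        refine ENNReal.rpow_ne_top_of_ne_zero ?_ enorm_ne_top
        simpa [sub_eq_zero] using hr1.ne
      simp_rw [hin]
      rw [lintegral_const_mul' _ _ (by finiteness), mul_assoc]
      calc _ ≤ 2 * ‖r - 1‖ₑ ^ (-(1 / 2) : ℝ) * (M + ‖r - ‖a‖‖ₑ ^ (-(1 / 4) : ℝ) * N) := by
            gcongr
            exact lintegral_circle_le hr hr1 a (τ (r ^ 2))
        _ = 2 * (M * ‖r - 1‖ₑ ^ (-(1 / 2) : ℝ) +
              N * (‖r - 1‖ₑ ^ (-(1 / 2) : ℝ) * ‖r - ‖a‖‖ₑ ^ (-(1 / 4) : ℝ))) := by ring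
        _ ≤ _ := by
            simp only [hG]
            gcongr
            exact rpow_neg_half_mul_rpow_neg_quarter_le _ _
    · have hin : ∀ θ, ENNReal.ofReal r * unitDisk.indicator F (r * cos θ, r * sin θ) = 0 := by
        intro θ
        rw [Set.indicator_of_notMem, mul_zero]
        change ¬ (r * cos θ) ^ 2 + (r * sin θ) ^ 2 < 1
        rw [hsq]
        nlinarith
      simp [hin]
  have hvol : volume (Set.Ioo (0 : ℝ) 1) = 1 := by simp
  have hbound : ∀ q : ℝ, 0 < q → ∀ c : ℝ,
      ∫⁻ r in Set.Ioo (0 : ℝ) 1, ‖r - c‖ₑ ^ (-q) ≤ 1 + I q := fun q hq c => by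
    simpa only [hvol, ← sub_eq_add_neg] using
      setLIntegral_enorm_add_rpow_neg_le hq (Set.Ioo (0 : ℝ) 1) (-c)
  calc ∫⁻ v in unitDisk, F v = ∫⁻ v, unitDisk.indicator F v := (lintegral_indicator hmeas _).symm
    _ = ∫⁻ p in Set.Ioi (0 : ℝ) ×ˢ Set.Ioo (-π) π,
          ENNReal.ofReal p.1 * unitDisk.indicator F (p.1 * cos p.2, p.1 * sin p.2) :=
        (lintegral_comp_polarCoord_symm _).symm
    _ ≤ ∫⁻ r in Set.Ioi (0 : ℝ), ∫⁻ θ in Set.Ioo (-π) π,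
          ENNReal.ofReal r * unitDisk.indicator F (r * cos θ, r * sin θ) := by
        rw [Measure.volume_eq_prod, ← Measure.prod_restrict]
        exact lintegral_prod_le _
    _ ≤ ∫⁻ r in Set.Ioi (0 : ℝ), (Set.Ioo (0 : ℝ) 1).indicator G r :=
        setLIntegral_mono' measurableSet_Ioi hradial
    _ ≤ ∫⁻ r, (Set.Ioo (0 : ℝ) 1).indicator G r := setLIntegral_le_lintegral _ _
    _ = 2 * (M * (∫⁻ r in Set.Ioo (0 : ℝ) 1, ‖r - 1‖ₑ ^ (-(1 / 2) : ℝ)) +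
          N * ((∫⁻ r in Set.Ioo (0 : ℝ) 1, ‖r - 1‖ₑ ^ (-(3 / 4) : ℝ)) +
            ∫⁻ r in Set.Ioo (0 : ℝ) 1, ‖r - ‖a‖‖ₑ ^ (-(3 / 4) : ℝ))) := by
        rw [lintegral_indicator measurableSet_Ioo, hG,
          lintegral_const_mul _ (by fun_prop), lintegral_add_left (by fun_prop),
          lintegral_const_mul _ (by fun_prop), lintegral_const_mul _ (by fun_prop),
          lintegral_add_left (by fun_prop)]
    _ ≤ _ := by
        gcongr <;> exact hbound _ (by norm_num) _

theorem one_sub_sq_pos_of_mem_unitDisk {v : ℝ × ℝ} (hv : v ∈ unitDisk) :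
    0 < 1 - (v.1 ^ 2 + v.2 ^ 2) ^ 2 := by
  have : v.1 ^ 2 + v.2 ^ 2 < 1 := hv
  nlinarith [sq_nonneg v.1, sq_nonneg v.2]

theorem hasFDerivAt_gcap {v : ℝ × ℝ} (hv : v ∈ unitDisk) :
    HasFDerivAt gcap ((1 / (2 * gcap v)) • (-((2 * (v.1 ^ 2 + v.2 ^ 2)) •
      ((2 * v.1) • ContinuousLinearMap.fst ℝ ℝ ℝ + (2 * v.2) • ContinuousLinearMap.snd ℝ ℝ ℝ)))) v := by
  have h1 : HasFDerivAt (fun v : ℝ × ℝ => v.1) (ContinuousLinearMap.fst ℝ ℝ ℝ) v := hasFDerivAt_fst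
  have h2 : HasFDerivAt (fun v : ℝ × ℝ => v.2) (ContinuousLinearMap.snd ℝ ℝ ℝ) v := hasFDerivAt_snd
  have h := ((((h1.pow 2).add (h2.pow 2)).pow 2).const_sub 1).sqrt (one_sub_sq_pos_of_mem_unitDisk hv).ne'
  refine h.congr_fderiv ?_
  simp [gcap, mul_add, add_comm]

/-- The area density of either half of the Korányi sphere, in terms of `R = |z|`. -/
theorem ofReal_sqrt_gcap_le {v : ℝ × ℝ} (hv : v ∈ unitDisk) {ε : ℝ} (hε : ε ^ 2 = 1) :
    ENNReal.ofReal (√((ε * fderiv ℝ gcap v (1, 0) - v.2) ^ 2 + (ε * fderiv ℝ gcap v (0, 1) + v.1) ^ 2))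
      ≤ 2 * ENNReal.ofReal √(v.1 ^ 2 + v.2 ^ 2) *
        ‖1 - √(v.1 ^ 2 + v.2 ^ 2)‖ₑ ^ (-(1 / 2) : ℝ) := by
  set R := √(v.1 ^ 2 + v.2 ^ 2) with hR
  have hR0 : 0 ≤ R := Real.sqrt_nonneg _
  have hRsq : R ^ 2 = v.1 ^ 2 + v.2 ^ 2 := Real.sq_sqrt (by positivity)
  have hR1 : R < 1 := by
    have : v.1 ^ 2 + v.2 ^ 2 < 1 := hv
    nlinarith
  have hg0 : 0 < 1 - (v.1 ^ 2 + v.2 ^ 2) ^ 2 := one_sub_sq_pos_of_mem_unitDisk hv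
  have hg : gcap v ^ 2 = 1 - R ^ 4 := by
    rw [gcap, Real.sq_sqrt hg0.le, ← hRsq]; ring
  have hgpos : 0 < gcap v := Real.sqrt_pos.2 hg0
  have hR4 : 0 < 1 - R ^ 4 := by rw [← hg]; positivity
  have hpos : 0 < 1 - R := by linarith
  have hd1 : fderiv ℝ gcap v (1, 0) = -(2 * R ^ 2 * v.1) / gcap v := by
    rw [(hasFDerivAt_gcap hv).fderiv, hRsq]
    simp
    field_simp
  have hd2 : fderiv ℝ gcap v (0, 1) = -(2 * R ^ 2 * v.2) / gcap v := by
    rw [(hasFDerivAt_gcap hv).fderiv, hRsq]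
    simp
    field_simp
  have hval : (ε * fderiv ℝ gcap v (1, 0) - v.2) ^ 2 + (ε * fderiv ℝ gcap v (0, 1) + v.1) ^ 2
      = R ^ 2 * (1 + 3 * R ^ 4) / (1 - R ^ 4) := by
    have hexp : (ε * (-(2 * R ^ 2 * v.1) / gcap v) - v.2) ^ 2
        + (ε * (-(2 * R ^ 2 * v.2) / gcap v) + v.1) ^ 2
        = 4 * R ^ 4 * ε ^ 2 / gcap v ^ 2 * (v.1 ^ 2 + v.2 ^ 2) + (v.1 ^ 2 + v.2 ^ 2) := by ring
    rw [hd1, hd2, hexp, ← hRsq, hε, hg]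
    field_simp
    ring
  have hle : √((ε * fderiv ℝ gcap v (1, 0) - v.2) ^ 2 + (ε * fderiv ℝ gcap v (0, 1) + v.1) ^ 2)
      ≤ 2 * R * (√(1 - R))⁻¹ := by
    rw [hval]
    refine Real.sqrt_le_iff.2 ⟨by positivity, ?_⟩
    rw [mul_pow, inv_pow, Real.sq_sqrt hpos.le, ← div_eq_mul_inv, div_le_div_iff₀ hR4 hpos]
    have hR41 : R ^ 4 ≤ R := by nlinarith [pow_le_one₀ hR0 hR1.le (n := 3)]
    have : (1 + 3 * R ^ 4) * (1 - R) ≤ 4 * (1 - R ^ 4) := by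
      nlinarith [pow_nonneg hR0 4, pow_nonneg hR0 5]
    nlinarith [sq_nonneg R]
  refine (ENNReal.ofReal_le_ofReal hle).trans_eq ?_
  rw [ENNReal.ofReal_mul (by positivity), ENNReal.ofReal_mul (by norm_num),
    Real.enorm_eq_ofReal hpos.le, ENNReal.ofReal_rpow_of_pos hpos, Real.rpow_neg hpos.le,
    Real.sqrt_eq_rpow, ENNReal.ofReal_ofNat]

theorem graphDens_gcap_le {v : ℝ × ℝ} (hv : v ∈ unitDisk) :
    ENNReal.ofReal (graphDens gcap v) ≤ 2 * ENNReal.ofReal √(v.1 ^ 2 + v.2 ^ 2) *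
        ‖1 - √(v.1 ^ 2 + v.2 ^ 2)‖ₑ ^ (-(1 / 2) : ℝ) := by
  simpa [graphDens] using ofReal_sqrt_gcap_le hv (one_pow 2)

theorem graphDens_neg_gcap_le {v : ℝ × ℝ} (hv : v ∈ unitDisk) :
    ENNReal.ofReal (graphDens (fun w => -gcap w) v) ≤ 2 * ENNReal.ofReal √(v.1 ^ 2 + v.2 ^ 2) *
        ‖1 - √(v.1 ^ 2 + v.2 ^ 2)‖ₑ ^ (-(1 / 2) : ℝ) := by
  simpa [graphDens, fderiv_fun_neg] using ofReal_sqrt_gcap_le hv (ε := -1) (by norm_num)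

theorem measurable_graphDens (u : ℝ × ℝ → ℝ) : Measurable (graphDens u) := by
  have h1 := measurable_fderiv_apply_const ℝ u (1, 0)
  have h2 := measurable_fderiv_apply_const ℝ u (0, 1)
  unfold graphDens
  fun_prop

theorem rho_sq (p : Heis) : rho p ^ 2 = √((p.1 ^ 2 + p.2.1 ^ 2) ^ 2 + p.2.2 ^ 2) := by
  rw [rho, ← Real.rpow_natCast, ← Real.rpow_mul (by positivity), Real.sqrt_eq_rpow]
  norm_num

/-- The case `r = 1` of the kernel estimate, uniformly in `y`. -/
theorem exists_lintegral_sigmaSphere_le :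
    ∃ K : ENNReal, K ≠ ⊤ ∧ ∀ y : Heis,
      ∫⁻ ξ, ENNReal.ofReal ((rho (Hmul (Hinv y) ξ) ^ 2)⁻¹) ∂sigmaSphere ≤ K := by
  obtain ⟨K, hK, hle⟩ := exists_lintegral_unitDisk_le
  have hmeas : MeasurableSet unitDisk :=
    measurableSet_lt (by fun_prop) measurable_const
  have hgraph : ∀ (u : ℝ × ℝ → ℝ) (τ : ℝ → ℝ), (∀ v, u v = τ (v.1 ^ 2 + v.2 ^ 2)) →
      (∀ v ∈ unitDisk, ENNReal.ofReal (graphDens u v) ≤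
        2 * ENNReal.ofReal √(v.1 ^ 2 + v.2 ^ 2) *
          ‖1 - √(v.1 ^ 2 + v.2 ^ 2)‖ₑ ^ (-(1 / 2) : ℝ)) →
      ∀ y : Heis, ∫⁻ ξ, ENNReal.ofReal ((rho (Hmul (Hinv y) ξ) ^ 2)⁻¹)
        ∂(Measure.map (fun v : ℝ × ℝ => (v.1, v.2, u v))
          ((volume.restrict unitDisk).withDensity fun v => ENNReal.ofReal (graphDens u v))) ≤ K := by
    intro u τ hu hdens y
    refine (lintegral_map_le _ _).trans ((lintegral_withDensity_le_lintegral_mul _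
      (measurable_graphDens u).ennreal_ofReal _).trans ((setLIntegral_mono' hmeas
        fun v hv => ?_).trans (hle ⟨y.1, y.2.1⟩ (fun s => τ s - y.2.2))))
    refine mul_le_mul' (hdens v hv) (ENNReal.ofReal_inv_le.trans_eq ?_)
    rw [rho_sq]
    simp only [Hmul, Hinv, hu]
    congr 3
    ring
  refine ⟨K + K, ENNReal.add_ne_top.2 ⟨hK, hK⟩, fun y => ?_⟩
  rw [sigmaSphere, lintegral_add_measure]
  exact add_le_add
    (hgraph gcap (fun s => √(1 - s ^ 2)) (fun _ => rfl) (fun _ => graphDens_gcap_le) y)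
    (hgraph (fun w => -gcap w) (fun s => -√(1 - s ^ 2)) (fun _ => rfl)
      (fun _ => graphDens_neg_gcap_le) y)

theorem rho_sq_Hmul_Hinv_Hdil {r : ℝ} (hr : 0 < r) (y ξ : Heis) :
    rho (Hmul (Hinv y) (Hdil r ξ)) ^ 2
      = r ^ 2 * rho (Hmul (Hinv (Hdil r⁻¹ y)) ξ) ^ 2 := by
  rw [rho_sq, rho_sq, ← Real.sqrt_sq (sq_nonneg r), ← Real.sqrt_mul (sq_nonneg _)]
  congr 1
  simp only [Hmul, Hinv, Hdil]
  field_simp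

theorem measurable_rho_Hmul (r : ℝ) :
    Measurable fun p : Heis × Heis => rho (Hmul (Hinv p.2) (Hdil r p.1)) := by
  unfold rho Hmul Hinv Hdil
  fun_prop

instance : SFinite sigmaSphere := by
  unfold sigmaSphere
  infer_instance

/-- uniformly in `y ∈ ℍ¹` and `r ≥ 1`, the average of `ρ(y⁻¹·δ_r(ξ))⁻²` over
the Korányi unit sphere is `O(1/r²)`; consequently, for `f ∈ L¹`, the spherical average
over `∂B_r` of the bound `∫ |f(y)| ρ(y⁻¹x)⁻² dv(y)` for `|Δ_b v|` is at most
`C‖f‖_{L¹}/r²`. -/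
theorem sphere_average_decay_two :
    ∃ C : ENNReal, C ≠ ⊤ ∧ ∀ r : ℝ, 1 ≤ r →
      (∀ y : Heis,
        (∫⁻ ξ, ENNReal.ofReal ((rho (Hmul (Hinv y) (Hdil r ξ)) ^ 2)⁻¹) ∂sigmaSphere)
            / sigmaSphere Set.univ
          ≤ C / ENNReal.ofReal (r ^ 2)) ∧
      ∀ f : Heis → ℝ, Integrable f volume →
        (∫⁻ ξ, (∫⁻ y, ENNReal.ofReal |f y| *
            ENNReal.ofReal ((rho (Hmul (Hinv y) (Hdil r ξ)) ^ 2)⁻¹)) ∂sigmaSphere)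
            / sigmaSphere Set.univ
          ≤ C * (∫⁻ y, ENNReal.ofReal |f y|) / ENNReal.ofReal (r ^ 2) := by
  obtain ⟨K, hK, hle⟩ := exists_lintegral_sigmaSphere_le
  have hker : ∀ r : ℝ, 1 ≤ r → ∀ y : Heis,
      ∫⁻ ξ, ENNReal.ofReal ((rho (Hmul (Hinv y) (Hdil r ξ)) ^ 2)⁻¹) ∂sigmaSphere
        ≤ K / ENNReal.ofReal (r ^ 2) := by
    intro r hr y
    have hr2 : 0 < r ^ 2 := by positivity
    simp_rw [rho_sq_Hmul_Hinv_Hdil (zero_lt_one.trans_le hr), mul_inv,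
      ENNReal.ofReal_mul (inv_nonneg.2 hr2.le), ENNReal.ofReal_inv_of_pos hr2]
    rw [lintegral_const_mul' _ _ (by simpa using (zero_lt_one.trans_le hr).ne'), mul_comm,
      ← div_eq_mul_inv]
    gcongr
    exact hle _
  have hfub : ∀ r : ℝ, 1 ≤ r → ∀ f : Heis → ℝ, Integrable f volume →
      ∫⁻ ξ, (∫⁻ y, ENNReal.ofReal |f y| *
          ENNReal.ofReal ((rho (Hmul (Hinv y) (Hdil r ξ)) ^ 2)⁻¹)) ∂sigmaSphere
        ≤ K * (∫⁻ y, ENNReal.ofReal |f y|) / ENNReal.ofReal (r ^ 2) := by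
    intro r hr f hf
    have hr2 : ENNReal.ofReal (r ^ 2) ≠ 0 := by simpa using (zero_lt_one.trans_le hr).ne'
    have hfm : AEMeasurable (fun p : Heis × Heis => f p.2) (sigmaSphere.prod volume) :=
      hf.aemeasurable.comp_snd
    rw [lintegral_lintegral_swap (by
      have := measurable_rho_Hmul r
      simp only [Function.uncurry_def]
      exact (hfm.abs.ennreal_ofReal).mul
        ((this.pow_const 2).inv.ennreal_ofReal.aemeasurable))]
    calc _ ≤ ∫⁻ y, ENNReal.ofReal |f y| * (K / ENNReal.ofReal (r ^ 2)) := by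
          refine lintegral_mono fun y => ?_
          rw [lintegral_const_mul' _ _ ENNReal.ofReal_ne_top]
          gcongr
          exact hker r hr y
      _ = _ := by
          rw [lintegral_mul_const' _ _ (ENNReal.div_ne_top hK hr2), mul_comm, ENNReal.mul_div_right_comm]
  by_cases hσ : sigmaSphere = 0
  · refine ⟨0, ENNReal.zero_ne_top, fun r _ => ⟨fun y => ?_, fun f _ => ?_⟩⟩ <;> simp [hσ]
  refine ⟨K / sigmaSphere Set.univ,
    ENNReal.div_ne_top hK (Measure.measure_univ_ne_zero.2 hσ), fun r hr =>
      ⟨fun y => ?_, fun f hf => ?_⟩⟩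
  · rw [ENNReal.div_right_comm]
    gcongr
    exact hker r hr y
  · refine (ENNReal.div_le_div_right (hfub r hr f hf) _).trans_eq ?_
    simp only [div_eq_mul_inv]
    ring

end
end

section
/- Fix q ∈ ℍ¹ and define F(p) := log ρ(q⁻¹p) for p ∈ ℍ¹∖{q}. Then Δ_b( Δ_b F )(p) = 8 ( t̃² − |z̃|⁴ ) / ( |z̃|⁴ + t̃² )², where (z̃, t̃) := q⁻¹p. In particular (taking q = 0), Δ_b²( log(|z|⁴+t²)^{1/4} ) = 8(t²−|z|⁴)/(|z|⁴+t²)² on ℍ¹∖{0}; up to a multiplicative constant this is the real part of the Szegő kernel, so log ρ(q⁻¹p) is, up to a multiplicative constant, the fundamental solution of the operator P' = 2Δ_b² on CR pluriharmonic functions. -/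
open MeasureTheory Real

noncomputable section

/-- The gauge polynomial `ρ⁴ = |z|⁴ + t²`. -/
def koranyiGauge (p : Heis) : ℝ := (p.1 ^ 2 + p.2.1 ^ 2) ^ 2 + p.2.2 ^ 2

/-- Chain rule for left translation by `a`; no differentiability of `f` is needed, since left
translation is a diffeomorphism. -/
lemma fderiv_comp_Hmul (f : Heis → ℝ) (a p : Heis) (v : Heis) :
    fderiv ℝ (fun x => f (Hmul a x)) p v =
      fderiv ℝ f (Hmul a p) (v.1, v.2.1, v.2.2 + 2 * (a.2.1 * v.1 - a.1 * v.2.1)) := by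
  have hd : ∀ b : Heis, Differentiable ℝ (Hmul b) := fun b => by
    unfold Hmul; fun_prop
  by_cases hf : DifferentiableAt ℝ f (Hmul a p)
  · have h1 : HasFDerivAt (Hmul a) _ p :=
      ((hasFDerivAt_fst (𝕜 := ℝ) (p := p)).const_add a.1).prodMk
        ((((hasFDerivAt_snd (𝕜 := ℝ) (p := p)).fst).const_add a.2.1).prodMk
          ((((hasFDerivAt_snd (𝕜 := ℝ) (p := p)).snd).const_add a.2.2).add
            ((((hasFDerivAt_fst (𝕜 := ℝ) (p := p)).const_mul a.2.1).sub
              (((hasFDerivAt_snd (𝕜 := ℝ) (p := p)).fst).const_mul a.1)).const_mul 2)))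
    have h2 := (hf.hasFDerivAt.comp p h1).fderiv
    change fderiv ℝ (f ∘ Hmul a) p v = _
    rw [h2]
    simp
  · have hg : ¬ DifferentiableAt ℝ (fun x => f (Hmul a x)) p := by
      intro h
      apply hf
      have e : ∀ x, Hmul (Hinv a) (Hmul a x) = x := fun x => by
        (ext <;> simp [Hmul, Hinv]); ring
      have e' : f = (fun x => f (Hmul a x)) ∘ Hmul (Hinv a) := by
        funext x
        have : Hmul a (Hmul (Hinv a) x) = x := by
          (ext <;> simp [Hmul, Hinv]); ring
        simp [this]
      rw [e']
      refine DifferentiableAt.comp _ ?_ (hd _ _)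
      rwa [e]
    rw [fderiv_zero_of_not_differentiableAt hf, fderiv_zero_of_not_differentiableAt hg]
    simp

lemma Xd_comp_Hmul (f : Heis → ℝ) (a : Heis) :
    Xd (fun x => f (Hmul a x)) = fun x => Xd f (Hmul a x) := by
  funext p
  simp only [Xd, fderiv_comp_Hmul]
  congr 2
  simp [Hmul]; ring

lemma Yd_comp_Hmul (f : Heis → ℝ) (a : Heis) :
    Yd (fun x => f (Hmul a x)) = fun x => Yd f (Hmul a x) := by
  funext p
  simp only [Yd, fderiv_comp_Hmul]
  congr 2
  simp [Hmul]; ring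

lemma subLap_comp_Hmul (f : Heis → ℝ) (a : Heis) :
    subLap (fun x => f (Hmul a x)) = fun x => subLap f (Hmul a x) := by
  funext p
  simp only [subLap, Xd_comp_Hmul, Yd_comp_Hmul]

lemma koranyiGauge_ne_zero {p : Heis} (hp : p ≠ 0) : koranyiGauge p ≠ 0 := by
  intro h
  apply hp
  unfold koranyiGauge at h
  have h1 : p.1 ^ 2 + p.2.1 ^ 2 = 0 := by
    nlinarith [sq_nonneg (p.1 ^ 2 + p.2.1 ^ 2), sq_nonneg p.2.2]
  ext
  · simp; nlinarith [sq_nonneg p.1, sq_nonneg p.2.1]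
  · simp; nlinarith [sq_nonneg p.1, sq_nonneg p.2.1]
  · rw [h1] at h; simpa using h

lemma Xd_congr {f g : Heis → ℝ} (h : ∀ x, x ≠ 0 → f x = g x) {p : Heis} (hp : p ≠ 0) :
    Xd f p = Xd g p := by
  have : f =ᶠ[nhds p] g := by
    filter_upwards [isOpen_ne.mem_nhds hp] with x hx using h x hx
  rw [Xd, Xd, this.fderiv_eq]

lemma Yd_congr {f g : Heis → ℝ} (h : ∀ x, x ≠ 0 → f x = g x) {p : Heis} (hp : p ≠ 0) :
    Yd f p = Yd g p := by
  have : f =ᶠ[nhds p] g := by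
    filter_upwards [isOpen_ne.mem_nhds hp] with x hx using h x hx
  rw [Yd, Yd, this.fderiv_eq]

lemma fderiv_div_apply {f g : Heis → ℝ} {p : Heis} (v : Heis) (hf : DifferentiableAt ℝ f p)
    (hg : DifferentiableAt ℝ g p) (h : g p ≠ 0) :
    fderiv ℝ (fun x => f x / g x) p v =
      (fderiv ℝ f p v * g p - f p * fderiv ℝ g p v) / g p ^ 2 := by
  have hinv := (hasDerivAt_inv h).comp_hasFDerivAt p hg.hasFDerivAt
  have hdiv := (hf.hasFDerivAt.mul hinv).fderiv
  change fderiv ℝ (f * (Inv.inv ∘ g)) p v = _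
  rw [hdiv]
  simp
  field_simp
  ring

lemma fderiv_mul_apply {f g : Heis → ℝ} {p : Heis} (v : Heis) (hf : DifferentiableAt ℝ f p)
    (hg : DifferentiableAt ℝ g p) :
    fderiv ℝ (fun x => f x * g x) p v = fderiv ℝ f p v * g p + f p * fderiv ℝ g p v := by
  rw [fderiv_fun_mul hf hg]
  simp
  ring

lemma fderiv_add_apply {f g : Heis → ℝ} {p : Heis} (v : Heis) (hf : DifferentiableAt ℝ f p)
    (hg : DifferentiableAt ℝ g p) :
    fderiv ℝ (fun x => f x + g x) p v = fderiv ℝ f p v + fderiv ℝ g p v := by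
  rw [fderiv_fun_add hf hg]; rfl

lemma fderiv_sub_apply {f g : Heis → ℝ} {p : Heis} (v : Heis) (hf : DifferentiableAt ℝ f p)
    (hg : DifferentiableAt ℝ g p) :
    fderiv ℝ (fun x => f x - g x) p v = fderiv ℝ f p v - fderiv ℝ g p v := by
  rw [fderiv_fun_sub hf hg]; rfl

lemma fderiv_pow_apply {f : Heis → ℝ} {p : Heis} (v : Heis) (n : ℕ)
    (hf : DifferentiableAt ℝ f p) :
    fderiv ℝ (fun x => f x ^ n) p v = n * f p ^ (n - 1) * fderiv ℝ f p v := by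
  rw [fderiv_fun_pow n hf]; simp

lemma fderiv_coord_x (p v : Heis) : fderiv ℝ (fun x : Heis => x.1) p v = v.1 := by
  rw [hasFDerivAt_fst.fderiv]; rfl

lemma fderiv_coord_y (p v : Heis) : fderiv ℝ (fun x : Heis => x.2.1) p v = v.2.1 := by
  rw [hasFDerivAt_snd.fst.fderiv]; rfl

lemma fderiv_coord_t (p v : Heis) : fderiv ℝ (fun x : Heis => x.2.2) p v = v.2.2 := by
  rw [hasFDerivAt_snd.snd.fderiv]; rfl

lemma fderiv_const_apply_apply (c : ℝ) (p v : Heis) : fderiv ℝ (fun _ : Heis => c) p v = 0 := by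
  simp

lemma differentiable_koranyiGauge : Differentiable ℝ koranyiGauge := by
  unfold koranyiGauge; fun_prop

lemma fderiv_koranyiGauge_apply (p v : Heis) : fderiv ℝ koranyiGauge p v =
    4 * (p.1 ^ 2 + p.2.1 ^ 2) * (p.1 * v.1 + p.2.1 * v.2.1) + 2 * p.2.2 * v.2.2 := by
  unfold koranyiGauge
  simp (disch := fun_prop) only [fderiv_add_apply, fderiv_pow_apply, fderiv_coord_x,
    fderiv_coord_y, fderiv_coord_t]
  push_cast
  ring

lemma log_rho (p : Heis) (hp : p ≠ 0) : Real.log (rho p) = 1 / 4 * Real.log (koranyiGauge p) := by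
  have : 0 < koranyiGauge p :=
    lt_of_le_of_ne (by unfold koranyiGauge; positivity) (koranyiGauge_ne_zero hp).symm
  exact Real.log_rpow this _

lemma fderiv_log_koranyiGauge_apply {p : Heis} (hp : p ≠ 0) (v : Heis) :
    fderiv ℝ (fun x => 1 / 4 * Real.log (koranyiGauge x)) p v =
      fderiv ℝ koranyiGauge p v / (4 * koranyiGauge p) := by
  have h := koranyiGauge_ne_zero hp
  rw [(((differentiable_koranyiGauge p).hasFDerivAt.log h).const_mul (1 / 4)).fderiv]
  simp
  field_simp

lemma Xd_log_rho {p : Heis} (hp : p ≠ 0) : Xd (fun x => Real.log (rho x)) p =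
    (p.1 * (p.1 ^ 2 + p.2.1 ^ 2) + p.2.1 * p.2.2) / koranyiGauge p := by
  have h := koranyiGauge_ne_zero hp
  rw [Xd_congr log_rho hp, Xd, fderiv_log_koranyiGauge_apply hp, fderiv_koranyiGauge_apply]
  field_simp
  ring

lemma Yd_log_rho {p : Heis} (hp : p ≠ 0) : Yd (fun x => Real.log (rho x)) p =
    (p.2.1 * (p.1 ^ 2 + p.2.1 ^ 2) - p.1 * p.2.2) / koranyiGauge p := by
  have h := koranyiGauge_ne_zero hp
  rw [Yd_congr log_rho hp, Yd, fderiv_log_koranyiGauge_apply hp, fderiv_koranyiGauge_apply]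
  field_simp
  ring

lemma subLap_log_rho {p : Heis} (hp : p ≠ 0) : subLap (fun x => Real.log (rho x)) p =
    2 * (p.1 ^ 2 + p.2.1 ^ 2) / koranyiGauge p := by
  have h := koranyiGauge_ne_zero hp
  have hg := differentiable_koranyiGauge p
  rw [subLap, Xd_congr (fun _ => Xd_log_rho) hp, Yd_congr (fun _ => Yd_log_rho) hp, Xd, Yd,
    fderiv_div_apply _ (by fun_prop) hg h, fderiv_div_apply _ (by fun_prop) hg h,
    fderiv_koranyiGauge_apply, fderiv_koranyiGauge_apply]
  simp (disch := fun_prop) only [fderiv_add_apply, fderiv_sub_apply, fderiv_mul_apply,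
    fderiv_pow_apply, fderiv_coord_x, fderiv_coord_y, fderiv_coord_t]
  field_simp
  unfold koranyiGauge
  push_cast
  ring

lemma Xd_subLap_log_rho {p : Heis} (hp : p ≠ 0) :
    Xd (subLap fun x => Real.log (rho x)) p =
      (4 * p.1 * koranyiGauge p - 8 * (p.1 ^ 2 + p.2.1 ^ 2) *
        (p.1 * (p.1 ^ 2 + p.2.1 ^ 2) + p.2.1 * p.2.2)) / koranyiGauge p ^ 2 := by
  have h := koranyiGauge_ne_zero hp
  have hg := differentiable_koranyiGauge p
  rw [Xd_congr (fun _ => subLap_log_rho) hp, Xd,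
    fderiv_div_apply _ (by fun_prop) hg h, fderiv_koranyiGauge_apply]
  simp (disch := fun_prop) only [fderiv_add_apply, fderiv_mul_apply, fderiv_const_apply_apply,
    fderiv_pow_apply, fderiv_coord_x, fderiv_coord_y]
  push_cast
  ring

lemma Yd_subLap_log_rho {p : Heis} (hp : p ≠ 0) :
    Yd (subLap fun x => Real.log (rho x)) p =
      (4 * p.2.1 * koranyiGauge p - 8 * (p.1 ^ 2 + p.2.1 ^ 2) *
        (p.2.1 * (p.1 ^ 2 + p.2.1 ^ 2) - p.1 * p.2.2)) / koranyiGauge p ^ 2 := by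
  have h := koranyiGauge_ne_zero hp
  have hg := differentiable_koranyiGauge p
  rw [Yd_congr (fun _ => subLap_log_rho) hp, Yd,
    fderiv_div_apply _ (by fun_prop) hg h, fderiv_koranyiGauge_apply]
  simp (disch := fun_prop) only [fderiv_add_apply, fderiv_mul_apply, fderiv_const_apply_apply,
    fderiv_pow_apply, fderiv_coord_x, fderiv_coord_y]
  push_cast
  ring

lemma subLap_subLap_log_rho {p : Heis} (hp : p ≠ 0) :
    subLap (subLap fun x => Real.log (rho x)) p =
      8 * (p.2.2 ^ 2 - (p.1 ^ 2 + p.2.1 ^ 2) ^ 2) / koranyiGauge p ^ 2 := by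
  have h := koranyiGauge_ne_zero hp
  have hg := differentiable_koranyiGauge
  rw [subLap, Xd_congr (fun _ => Xd_subLap_log_rho) hp, Yd_congr (fun _ => Yd_subLap_log_rho) hp,
    Xd, Yd, fderiv_div_apply _ (by fun_prop) (by fun_prop) (pow_ne_zero 2 h),
    fderiv_div_apply _ (by fun_prop) (by fun_prop) (pow_ne_zero 2 h)]
  simp (disch := fun_prop) only [fderiv_add_apply, fderiv_sub_apply, fderiv_mul_apply,
    fderiv_const_apply_apply, fderiv_pow_apply, fderiv_coord_x, fderiv_coord_y, fderiv_coord_t,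
    fderiv_koranyiGauge_apply]
  field_simp
  unfold koranyiGauge
  push_cast
  ring

/-- for fixed `q`, with `F(p) = log ρ(q⁻¹p)` one has
`Δ_b(Δ_b F)(p) = 8(t̃² − |z̃|⁴)/(|z̃|⁴+t̃²)²` where `(z̃,t̃) = q⁻¹p`; in particular, for
`q = 0`, `Δ_b²(log ρ) = 8(t²−|z|⁴)/(|z|⁴+t²)²` on `ℍ¹∖{0}` — up to a multiplicative
constant the real part of the Szegő kernel, so `log ρ(q⁻¹p)` is (up to constant) the
fundamental solution of `P' = 2Δ_b²` on CR pluriharmonic functions. -/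
theorem subLap_sq_log_rho :
    (∀ q p : Heis, p ≠ q →
      subLap (subLap (fun x => Real.log (rho (Hmul (Hinv q) x)))) p =
        8 * ((Hmul (Hinv q) p).2.2 ^ 2 -
              ((Hmul (Hinv q) p).1 ^ 2 + (Hmul (Hinv q) p).2.1 ^ 2) ^ 2) /
          (((Hmul (Hinv q) p).1 ^ 2 + (Hmul (Hinv q) p).2.1 ^ 2) ^ 2 +
              (Hmul (Hinv q) p).2.2 ^ 2) ^ 2) ∧
    ∀ p : Heis, p ≠ (0, 0, 0) →
      subLap (subLap (fun x => Real.log (rho x))) p =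
        8 * (p.2.2 ^ 2 - (p.1 ^ 2 + p.2.1 ^ 2) ^ 2) /
          ((p.1 ^ 2 + p.2.1 ^ 2) ^ 2 + p.2.2 ^ 2) ^ 2 := by
  refine ⟨fun q p hpq => ?_, fun p hp => subLap_subLap_log_rho hp⟩
  have hne : Hmul (Hinv q) p ≠ 0 := by
    intro h
    apply hpq
    simp only [Hmul, Hinv, Prod.ext_iff, Prod.fst_zero, Prod.snd_zero] at h
    obtain ⟨h1, h2, h3⟩ := h
    have e1 : p.1 = q.1 := by linarith
    have e2 : p.2.1 = q.2.1 := by linarith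
    rw [e1, e2] at h3
    exact Prod.ext e1 (Prod.ext e2 (by linarith))
  rw [subLap_comp_Hmul (fun x => Real.log (rho x)), subLap_comp_Hmul]
  exact subLap_subLap_log_rho hne

end
end
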